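/- arXiv:0706.1784 — 2 statements merged into one kernel-verified Lean document; each statement's English description precedes it below -/
import Mathlib

section
/- Let G be a finite group acting freely on a set V and let ι : V → V be an involution commuting with the G-action. Suppose that for every g ∈ G the set Fix(g∘ι) = {x ∈ V : g·ι(x) = x} is finite. Let V/G be the quotient of V by the G-action and let ῑ be the involution of V/G induced by ι. Then the fixed-point set of ῑ on V/G is finite and |G| · |Fix(ῑ)| = Σ_{g∈G} |Fix(g∘ι)|, the sum running over all elements of G (including the identity). (Set-theoretic content of formula (5) of the paper, which for |G| = 8 reads ρ̄ = ρ/8 + (1/8)Σ_{g≠1} n_{gι}.) -/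
/-- Set-theoretic content of formula (5) of the paper: let a finite group `G` act
freely on `V`, let `ι` be a commuting involution and suppose every
`Fix(g∘ι) = {x | g • ι x = x}` is finite. Let `π : V → Q` be the quotient of `V`
by the `G`-action and `ιbar` the induced involution on `Q`. Then the fixed-point
set of `ιbar` is finite and `|G| · |Fix(ιbar)| = Σ_{g ∈ G} |Fix(g∘ι)|`. -/
theorem stmt_5 {G V Q : Type*} [Group G] [Fintype G] [MulAction G V]
    (ι : V → V) (hι : ∀ x, ι (ι x) = x)
    (hfree : ∀ (g : G) (x : V), g • x = x → g = 1)
    (hcomm : ∀ (g : G) (x : V), ι (g • x) = g • ι x)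
    (π : V → Q) (hsurj : Function.Surjective π)
    (hident : ∀ x y : V, π x = π y ↔ ∃ g : G, y = g • x)
    (ιbar : Q → Q) (hbar : ∀ x : V, ιbar (π x) = π (ι x))
    (hfin : ∀ g : G, {x : V | g • ι x = x}.Finite) :
    {q : Q | ιbar q = q}.Finite ∧
    Nat.card G * {q : Q | ιbar q = q}.ncard = ∑ g : G, {x : V | g • ι x = x}.ncard := by
  have hfix : ∀ x : V, ιbar (π x) = π x ↔ ∃ g : G, g • ι x = x := by
    intro x
    rw [hbar, hident]
    exact ⟨fun ⟨g, h⟩ => ⟨g, h.symm⟩, fun ⟨g, h⟩ => ⟨g, h.symm⟩⟩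
  have hcancel : ∀ (g h : G) (x : V), g • x = h • x → g = h := by
    intro g h x e
    have e2 : (h⁻¹ * g) • x = x := by rw [mul_smul, e, inv_smul_smul]
    have e3 := hfree _ _ e2
    rw [inv_mul_eq_one] at e3
    exact e3.symm
  obtain ⟨s, hs⟩ := hsurj.hasRightInverse
  have hfinQ : {q : Q | ιbar q = q}.Finite := by
    refine ((Set.finite_iUnion hfin).image π).subset ?_
    intro q hq
    obtain ⟨x, rfl⟩ := hsurj q
    obtain ⟨g, hg⟩ := (hfix x).1 hq
    exact ⟨x, Set.mem_iUnion.2 ⟨g, hg⟩, rfl⟩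
  refine ⟨hfinQ, ?_⟩
  have hπ : ∀ (g : G) (x : V), π (g • x) = π x := fun g x =>
    ((hident x (g • x)).2 ⟨g, rfl⟩).symm
  let A : (Σ g : G, {x : V | g • ι x = x}) → V := fun p => p.2.1
  let B : G × {q : Q | ιbar q = q} → V := fun p => p.1 • s p.2.1
  have hA : Function.Injective A := by
    rintro ⟨g, x, hx⟩ ⟨h, y, hy⟩ e
    have e' : x = y := e
    subst e'
    have : g = h := hcancel g h (ι x) (Eq.trans hx (Eq.symm hy))
    subst this
    rfl
  have hB : Function.Injective B := by
    rintro ⟨g, q, hq⟩ ⟨h, r, hr⟩ e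
    have e' : g • s q = h • s r := e
    have e2 : q = r := by
      have := congrArg π e'
      rwa [hπ, hπ, hs, hs] at this
    subst e2
    have : g = h := hcancel _ _ _ e'
    subst this
    rfl
  have hr : Set.range A = Set.range B := by
    ext x
    constructor
    · rintro ⟨⟨g, y, hy⟩, rfl⟩
      have h1 : ιbar (π y) = π y := (hfix y).2 ⟨g, hy⟩
      obtain ⟨k, hk⟩ := (hident (s (π y)) y).1 (hs _)
      exact ⟨⟨k, π y, h1⟩, hk.symm⟩
    · rintro ⟨⟨h, q, hq⟩, rfl⟩
      have h1 : π (h • s q) = q := by rw [hπ, hs]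
      have h2 : ιbar (π (h • s q)) = π (h • s q) := by rw [h1]; exact hq
      obtain ⟨g, hg⟩ := (hfix _).1 h2
      exact ⟨⟨g, h • s q, hg⟩, rfl⟩
  have hc : Nat.card (Σ g : G, {x : V | g • ι x = x}) = Nat.card (G × {q : Q | ιbar q = q}) := by
    rw [← Nat.card_range_of_injective hA, ← Nat.card_range_of_injective hB, hr]
  haveI : ∀ g : G, Finite {x : V | g • ι x = x} := fun g => (hfin g).to_subtype
  rw [Nat.card_sigma, Nat.card_prod] at hc
  simp only [Nat.card_coe_set_eq] at hc
  exact hc.symm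
end

section
/- Let r ≥ 1 and d ≥ 2r−1 be integers and let p₁, …, p_d be nonzero vectors in ℂ^r such that the corresponding points of ℙ^{r−1} are in general position, i.e. every subset of at most r of the vectors p₁, …, p_d is linearly independent. Consider the linear evaluation map sending a homogeneous polynomial q of degree 2 in r variables over ℂ to the vector (q(p₁), …, q(p_d)) ∈ ℂ^d. Then the rank of this evaluation map is at least 2r−1; that is, the Hilbert function of the point set Γ = {p₁,…,p_d} ⊂ ℙ^{r−1} satisfies h_Γ(2) ≥ 2r−1. -/
lemma exists_form {r d : ℕ} (p : Fin d → (Fin r → ℂ)) (s : Finset (Fin d))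
    (h : LinearIndependent ℂ (fun i : s => p i.1)) (i : Fin d) (hi : i ∈ s) :
    ∃ L : MvPolynomial (Fin r) ℂ, L.IsHomogeneous 1 ∧ MvPolynomial.aeval (p i) L = (1 : ℂ) ∧
      ∀ j ∈ s, j ≠ i → MvPolynomial.aeval (p j) L = (0 : ℂ) := by
  classical
  obtain ⟨g, hg⟩ := LinearMap.exists_leftInverse_of_injective
    (Finsupp.linearCombination ℂ (fun i : s => p i.1)) (LinearMap.ker_eq_bot.2 h)
  have key : ∀ j : s, g (p j.1) = Finsupp.single j 1 := by
    intro j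
    have := LinearMap.congr_fun hg (Finsupp.single j 1)
    simpa using this
  let φ : (Fin r → ℂ) →ₗ[ℂ] ℂ := (Finsupp.lapply (⟨i, hi⟩ : s)) ∘ₗ g
  have hL : ∀ v : Fin r → ℂ, MvPolynomial.aeval v
      (∑ k, MvPolynomial.C (φ (Pi.single k 1)) * MvPolynomial.X k :
        MvPolynomial (Fin r) ℂ) = φ v := by
    intro v
    conv_rhs => rw [LinearMap.pi_apply_eq_sum_univ φ v]
    simp only [map_sum, map_mul, MvPolynomial.aeval_X, MvPolynomial.aeval_C]
    refine Finset.sum_congr rfl fun k _ => ?_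
    rw [smul_eq_mul, mul_comm]
    have e : (Pi.single k 1 : Fin r → ℂ) = fun j => if k = j then 1 else 0 := by
      ext l
      simp [Pi.single_apply, eq_comm]
    rw [e]
    rfl
  refine ⟨_, ?_, (hL _).trans ?_, fun j hj hji => (hL _).trans ?_⟩
  · refine MvPolynomial.IsHomogeneous.sum _ _ _ fun k _ => ?_
    simpa using (MvPolynomial.isHomogeneous_C (Fin r) (φ (Pi.single k 1))).mul
      (MvPolynomial.isHomogeneous_X ℂ k)
  · simp [φ, key ⟨i, hi⟩]
  · simp [φ, key ⟨j, hj⟩, hji]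

/-- Let `r ≥ 1`, `d ≥ 2r - 1`, and let `p₁, …, p_d` be nonzero vectors of `ℂʳ`
representing points of `ℙ^{r-1}` in general position (every subset of at most `r`
of the vectors is linearly independent). Then the evaluation map from homogeneous
polynomials of degree 2 in `r` variables to `ℂᵈ`, `q ↦ (q(p₁), …, q(p_d))`, has
rank at least `2r - 1`; i.e. the Hilbert function satisfies `h_Γ(2) ≥ 2r - 1`. -/
theorem stmt_9 (r d : ℕ) (hr : 1 ≤ r) (hd : 2 * r - 1 ≤ d)
    (p : Fin d → (Fin r → ℂ)) (hp : ∀ i, p i ≠ 0)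
    (hgen : ∀ s : Finset (Fin d), s.card ≤ r →
      LinearIndependent ℂ (fun i : s => p i.1)) :
    2 * r - 1 ≤ Module.finrank ℂ
      (LinearMap.range
        ((LinearMap.pi fun i : Fin d => (MvPolynomial.aeval (p i)).toLinearMap) ∘ₗ
          (MvPolynomial.homogeneousSubmodule (Fin r) ℂ 2).subtype)) := by
  classical
  obtain ⟨S, -, hS⟩ := Finset.exists_subset_card_eq
    (s := (Finset.univ : Finset (Fin d))) (n := 2 * r - 1) (by simpa using hd)
  have hq : ∀ i : S, ∃ q : MvPolynomial (Fin r) ℂ, q.IsHomogeneous 2 ∧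
      MvPolynomial.aeval (p i.1) q = (1 : ℂ) ∧
      ∀ j ∈ S, j ≠ i.1 → MvPolynomial.aeval (p j) q = (0 : ℂ) := by
    rintro ⟨i, hi⟩
    have hc : (S.erase i).card = 2 * r - 2 := by rw [Finset.card_erase_of_mem hi]; omega
    obtain ⟨A, hA, hAc⟩ := Finset.exists_subset_card_eq
      (s := S.erase i) (n := r - 1) (by omega)
    have hBc : ((S.erase i) \ A).card = r - 1 := by
      rw [Finset.card_sdiff_of_subset hA]; omega
    obtain ⟨f, hf, hf1, hf0⟩ := exists_form p (insert i A)
      (hgen _ ((Finset.card_insert_le _ _).trans (by omega))) i (Finset.mem_insert_self _ _)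
    obtain ⟨g, hg, hg1, hg0⟩ := exists_form p (insert i ((S.erase i) \ A))
      (hgen _ ((Finset.card_insert_le _ _).trans (by omega))) i (Finset.mem_insert_self _ _)
    refine ⟨f * g, hf.mul hg, by rw [map_mul, hf1, hg1, one_mul], fun j hj hji => ?_⟩
    rw [map_mul]
    by_cases hjA : j ∈ A
    · rw [hf0 j (Finset.mem_insert_of_mem hjA) hji, zero_mul]
    · rw [hg0 j (Finset.mem_insert_of_mem (by simp [hjA, hj]; exact hji)) hji, mul_zero]
  choose q hq2 hq1 hq0 using hq
  set T := ((LinearMap.pi fun i : Fin d => (MvPolynomial.aeval (p i)).toLinearMap) ∘ₗ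
          (MvPolynomial.homogeneousSubmodule (Fin r) ℂ 2).subtype) with hT
  let w : S → LinearMap.range T := fun i =>
    ⟨T ⟨q i, (MvPolynomial.mem_homogeneousSubmodule _ _).2 (hq2 i)⟩, LinearMap.mem_range_self _ _⟩
  have hw : ∀ i j : S, (w i).1 j.1 = if i = j then 1 else 0 := by
    intro i j
    change MvPolynomial.aeval (p j.1) (q i) = _
    split_ifs with h
    · rw [← h]; exact hq1 i
    · exact hq0 i j.1 j.2 fun h' => h (Subtype.ext h'.symm)
  have hli : LinearIndependent ℂ w := by
    rw [Fintype.linearIndependent_iff]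
    intro c hc j
    have := congrFun (congrArg Subtype.val hc) j.1
    simpa [Finset.sum_apply, hw] using this
  have := hli.fintype_card_le_finrank
  rwa [Fintype.card_coe, hS] at this
end
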